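/- There exists a constant c > 0, depending only on λ = sup_k m_k, such that for every martingale f ∈ H_{1/2} the weighted maximal operator of Fejér means satisfies ‖ sup_{n≥1} |σ_n f| / log²(n+1) ‖_{L_{1/2}(μ)} ≤ c · ‖f‖_{H_{1/2}}. -/

import Mathlib

open MeasureTheory Complex Finset
open scoped BigOperators ENNReal NNReal

noncomputable section

instance (n : ℕ) : MeasurableSpace (ZMod n) := ⊤

/-- The Vilenkin group determined by the generating sequence `m`. -/
abbrev Gm (m : ℕ → ℕ) : Type := ∀ _k : ℕ, ZMod (m _k)

namespace Vilenkin

variable (m : ℕ → ℕ)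

/-- The generalized powers `M_0 = 1`, `M_{k+1} = m_k · M_k`. -/
def M : ℕ → ℕ
  | 0 => 1
  | k + 1 => m k * M k

/-- The `j`-th digit `n_j` of `n` in the generalized number system based on `m`. -/
def digit (n j : ℕ) : ℕ := n / M m j % m j

/-- `|n|`, the index of the highest nonzero digit of `n`. -/
def hi (n : ℕ) : ℕ := Nat.findGreatest (fun j => digit m n j ≠ 0) n

/-- `⟨n⟩`, the index of the lowest nonzero digit of `n`. -/
def lo (n : ℕ) : ℕ := sInf {j | digit m n j ≠ 0}

/-- The generalized Rademacher functions `r_k(x) = exp(2πi x_k / m_k)`. -/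
def rad (k : ℕ) (x : Gm m) : ℂ :=
  Complex.exp (2 * Real.pi * Complex.I * ((x k).val : ℂ) / (m k : ℂ))

/-- The Vilenkin functions `ψ_n = ∏_k r_k^{n_k}`. -/
def vil (n : ℕ) (x : Gm m) : ℂ :=
  ∏ k ∈ Finset.range (n + 1), rad m k x ^ digit m n k

/-- The Dirichlet kernels `D_n = ∑_{k=0}^{n-1} ψ_k`. -/
def D (n : ℕ) (x : Gm m) : ℂ := ∑ k ∈ Finset.range n, vil m k x

/-- The Fejér kernels `K_n = (1/n) ∑_{k=1}^{n} D_k`. -/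
def K (n : ℕ) (x : Gm m) : ℂ := (n : ℂ)⁻¹ * ∑ k ∈ Finset.range n, D m (k + 1) x

/-- The Nörlund kernels `F_n = (1/Q_n) ∑_{k=1}^{n} q_{n-k} D_k` where
`Q_n = ∑_{k=0}^{n-1} q_k`. -/
def FK (q : ℕ → ℝ) (n : ℕ) (x : Gm m) : ℂ :=
  ((∑ k ∈ Finset.range n, q k : ℝ) : ℂ)⁻¹ *
    ∑ k ∈ Finset.range n, (q (n - (k + 1)) : ℂ) * D m (k + 1) x

/-- The cylinder subgroup `I_n = {x : x_0 = … = x_{n-1} = 0}`. -/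
def I (n : ℕ) : Set (Gm m) := {x | ∀ k < n, x k = 0}

/-- The cylinder of length `n` around `x`. -/
def cylAt (n : ℕ) (x : Gm m) : Set (Gm m) := {y | ∀ k < n, y k = x k}

/-- `μ` is the normalized Haar measure of `G_m`: the (unique) Borel probability
measure giving each cylinder of length `n` measure `1 / M_n`. -/
def IsHaar (μ : Measure (Gm m)) : Prop :=
  ∀ (n : ℕ) (x : Gm m), μ (cylAt m n x) = (M m n : ℝ≥0∞)⁻¹

/-- A martingale with respect to the filtration `(ℱ_n)` on `G_m`, where `ℱ_n` is
generated by the first `n` coordinates: each `f n` is integrable and depends only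
on the first `n` coordinates, and the conditional expectation of `f N` with
respect to `ℱ_n` (which under the Haar measure is given by averaging over the
cylinders of length `n`) equals `f n` for `n ≤ N`. -/
structure IsMartingale (μ : Measure (Gm m)) (f : ℕ → Gm m → ℂ) : Prop where
  integrable : ∀ n, Integrable (f n) μ
  adapted : ∀ (n : ℕ) (x y : Gm m), (∀ k < n, x k = y k) → f n x = f n y
  mart : ∀ n N : ℕ, n ≤ N → ∀ x : Gm m,
    f n x = (M m n : ℂ) * ∫ t in cylAt m n x, f N t ∂μ

/-- The Vilenkin–Fourier coefficients of a martingale: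
`f̂(i) = lim_k ∫ f^(k) conj(ψ_i) dμ`; for a martingale these integrals are
constant as soon as `M_k > i`, in particular from `k = i + 1` on. -/
def coeff (μ : Measure (Gm m)) (f : ℕ → Gm m → ℂ) (i : ℕ) : ℂ :=
  ∫ x, f (i + 1) x * (starRingEnd ℂ) (vil m i x) ∂μ

/-- The partial sums `S_n f = ∑_{k=0}^{n-1} f̂(k) ψ_k`. -/
def S (μ : Measure (Gm m)) (f : ℕ → Gm m → ℂ) (n : ℕ) (x : Gm m) : ℂ :=
  ∑ k ∈ Finset.range n, coeff m μ f k * vil m k x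

/-- The Fejér means `σ_n f = (1/n) ∑_{k=1}^{n} S_k f`. -/
def sigma (μ : Measure (Gm m)) (f : ℕ → Gm m → ℂ) (n : ℕ) (x : Gm m) : ℂ :=
  (n : ℂ)⁻¹ * ∑ k ∈ Finset.range n, S m μ f (k + 1) x

/-- The Nörlund means `t_n f = (1/Q_n) ∑_{k=1}^{n} q_{n-k} S_k f`. -/
def T (μ : Measure (Gm m)) (q : ℕ → ℝ) (f : ℕ → Gm m → ℂ) (n : ℕ) (x : Gm m) : ℂ :=
  ((∑ k ∈ Finset.range n, q k : ℝ) : ℂ)⁻¹ *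
    ∑ k ∈ Finset.range n, (q (n - (k + 1)) : ℂ) * S m μ f (k + 1) x

/-- The martingale maximal function `f* = sup_n |f^(n)|`. -/
def mstar (f : ℕ → Gm m → ℂ) (x : Gm m) : ℝ≥0∞ := ⨆ n, (‖f n x‖₊ : ℝ≥0∞)

/-- The `L_p`-type quasi-norm `(∫ g^p dμ)^{1/p}` of an `ℝ≥0∞`-valued function. -/
def eLp (μ : Measure (Gm m)) (p : ℝ) (g : Gm m → ℝ≥0∞) : ℝ≥0∞ :=
  (∫⁻ x, g x ^ p ∂μ) ^ (1 / p)

/-- Membership in the martingale Hardy space `H_p`: `‖f‖_{H_p} = ‖f*‖_{L_p} < ∞`. -/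
def MemHp (μ : Measure (Gm m)) (p : ℝ) (f : ℕ → Gm m → ℂ) : Prop :=
  eLp m μ p (mstar m f) ≠ ⊤

/-- The weak-`L_p` quasi-norm `sup_{t>0} t · μ(g > t)^{1/p}`. -/
def wLp (μ : Measure (Gm m)) (p : ℝ) (g : Gm m → ℝ≥0∞) : ℝ≥0∞ :=
  ⨆ t : ℝ≥0, (t : ℝ≥0∞) * μ {x | (t : ℝ≥0∞) < g x} ^ (1 / p)

end Vilenkin

namespace Vilenkin

section Kernel

variable {m : ℕ → ℕ}

lemma M_succ (k : ℕ) : M m (k + 1) = m k * M m k := rfl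

lemma M_pos (hm : ∀ k, 2 ≤ m k) (k : ℕ) : 0 < M m k := by
  induction k with
  | zero => simp [M]
  | succ k ih => exact Nat.mul_pos (by linarith [hm k]) ih

lemma two_mul_M_le (hm : ∀ k, 2 ≤ m k) (k : ℕ) : 2 * M m k ≤ M m (k + 1) :=
  Nat.mul_le_mul_right _ (hm k)

lemma two_pow_le_M (hm : ∀ k, 2 ≤ m k) (k : ℕ) : 2 ^ k ≤ M m k := by
  induction k with
  | zero => simp [M]
  | succ k ih =>
    have := two_mul_M_le hm k
    rw [pow_succ]
    omega

lemma lt_M_self (hm : ∀ k, 2 ≤ m k) (k : ℕ) : k < M m k :=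
  k.lt_two_pow_self.trans_le (two_pow_le_M hm k)

lemma M_mono (hm : ∀ k, 2 ≤ m k) : Monotone (M m) :=
  monotone_nat_of_le_succ fun k => by
    have := two_mul_M_le hm k
    omega

lemma M_dvd {i j : ℕ} (h : i ≤ j) : M m i ∣ M m j := by
  induction j, h using Nat.le_induction with
  | base => exact dvd_rfl
  | succ j _ ih => exact ih.trans (Dvd.intro_left _ rfl)

lemma neZero_of_two_le (hm : ∀ k, 2 ≤ m k) (k : ℕ) : NeZero (m k) :=
  ⟨by linarith [hm k]⟩

lemma rad_eq (hm : ∀ k, 2 ≤ m k) (k : ℕ) (x : Gm m) :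
    haveI := neZero_of_two_le hm k
    rad m k x = ZMod.stdAddChar (x k) := by
  have := neZero_of_two_le hm k
  rw [ZMod.stdAddChar_apply, ZMod.toCircle_apply, rad]

lemma norm_rad (hm : ∀ k, 2 ≤ m k) (k : ℕ) (x : Gm m) : ‖rad m k x‖ = 1 := by
  have := neZero_of_two_le hm k
  rw [rad_eq hm, ZMod.stdAddChar_apply]
  exact Circle.norm_coe _

lemma rad_mul_conj (hm : ∀ k, 2 ≤ m k) (k : ℕ) (x t : Gm m) :
    rad m k x * (starRingEnd ℂ) (rad m k t) = rad m k (x - t) := by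
  have := neZero_of_two_le hm k
  rw [rad_eq hm, rad_eq hm, rad_eq hm, Pi.sub_apply, AddChar.map_sub_eq_div, div_eq_mul_inv,
    ZMod.stdAddChar_apply, ZMod.stdAddChar_apply, ← Circle.coe_inv_eq_conj, Circle.coe_inv]

lemma geom_sum_rad (hm : ∀ k, 2 ≤ m k) (k : ℕ) (x : Gm m) :
    ∑ b ∈ range (m k), rad m k x ^ b = if x k = 0 then (m k : ℂ) else 0 := by
  have := neZero_of_two_le hm k
  split_ifs with h
  · simp [rad_eq hm, h]
  · have h1 : rad m k x - 1 ≠ 0 := by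
      rw [sub_ne_zero, rad_eq hm, ← AddChar.map_zero_eq_one (ZMod.stdAddChar (N := m k))]
      exact fun h' => h (ZMod.injective_stdAddChar h')
    have h2 : rad m k x ^ m k = 1 := by
      rw [rad_eq hm, ← AddChar.map_nsmul_eq_pow]
      simp
    have h3 := geom_sum_mul (rad m k x) (m k)
    rw [h2, sub_self] at h3
    exact (mul_eq_zero.mp h3).resolve_right h1

lemma digit_eq_zero (hm : ∀ k, 2 ≤ m k) {n L k : ℕ} (hn : n < M m L) (hk : L ≤ k) :
    digit m n k = 0 := by
  simp [digit, Nat.div_eq_of_lt (hn.trans_le (M_mono hm hk))]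

lemma vil_eq_prod (hm : ∀ k, 2 ≤ m k) {n L : ℕ} (hn : n < M m L) (x : Gm m) :
    vil m n x = ∏ k ∈ range L, rad m k x ^ digit m n k := by
  have key : ∀ L' L'' : ℕ, L' ≤ L'' → n < M m L' →
      ∏ k ∈ range L', rad m k x ^ digit m n k = ∏ k ∈ range L'', rad m k x ^ digit m n k := by
    intro L' L'' h hn
    refine Finset.prod_subset (by simpa using h) fun k _ hk => ?_
    rw [digit_eq_zero hm hn (by simpa using hk), pow_zero]
  have h1 : n < M m (n + 1) := n.lt_succ_self.trans (lt_M_self hm _)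
  rw [vil]
  rcases le_total L (n + 1) with h | h
  · exact (key _ _ h hn).symm
  · exact key _ _ h h1

lemma digit_add_of_lt {N a i j : ℕ} (hm : ∀ k, 2 ≤ m k) (hj : j < N) :
    digit m (a * M m N + i) j = digit m i j := by
  obtain ⟨c, hc⟩ := M_dvd (m := m) (Nat.succ_le_of_lt hj)
  have h : a * M m N + i = i + M m j * (m j * (a * c)) := by
    rw [hc, Nat.succ_eq_add_one, M_succ]
    ring
  rw [digit, digit, h, Nat.add_mul_div_left _ _ (M_pos hm j), Nat.add_mul_mod_self_left]

lemma digit_add_self {N a i : ℕ} (hm : ∀ k, 2 ≤ m k) (ha : a < m N) (hi : i < M m N) :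
    digit m (a * M m N + i) N = a := by
  rw [digit, add_comm, Nat.add_mul_div_right _ _ (M_pos hm N), Nat.div_eq_of_lt hi, zero_add,
    Nat.mod_eq_of_lt ha]

lemma vil_add (hm : ∀ k, 2 ≤ m k) {N a i : ℕ} (ha : a < m N) (hi : i < M m N) (x : Gm m) :
    vil m (a * M m N + i) x = rad m N x ^ a * vil m i x := by
  have h : a * M m N + i < M m (N + 1) := by
    rw [M_succ]
    nlinarith [Nat.mul_le_mul_right (M m N) (Nat.succ_le_of_lt ha)]
  rw [vil_eq_prod hm h, vil_eq_prod hm hi, prod_range_succ, digit_add_self hm ha hi, mul_comm]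
  congr 1
  exact prod_congr rfl fun j hj => by rw [digit_add_of_lt hm (by simpa using hj)]

lemma norm_vil (hm : ∀ k, 2 ≤ m k) (n : ℕ) (x : Gm m) : ‖vil m n x‖ = 1 := by
  simp [vil, norm_rad hm]

lemma vil_mul_conj (hm : ∀ k, 2 ≤ m k) (n : ℕ) (x t : Gm m) :
    vil m n x * (starRingEnd ℂ) (vil m n t) = vil m n (x - t) := by
  simp only [vil, map_prod, map_pow, ← prod_mul_distrib, ← mul_pow, rad_mul_conj hm]

/-- The unnormalized Fejér kernel `n K_n`. -/
def fejerSum (m : ℕ → ℕ) (n : ℕ) (x : Gm m) : ℂ := ∑ k ∈ range n, D m (k + 1) x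

lemma D_add (hm : ∀ k, 2 ≤ m k) {N a n : ℕ} (ha : a < m N) (hn : n ≤ M m N) (x : Gm m) :
    D m (a * M m N + n) x = D m (a * M m N) x + rad m N x ^ a * D m n x := by
  rw [D, sum_range_add, D, D, mul_sum]
  congr 1
  exact sum_congr rfl fun i hi => vil_add hm ha (lt_of_lt_of_le (by simpa using hi) hn) x

lemma D_mul (hm : ∀ k, 2 ≤ m k) {N a : ℕ} (ha : a ≤ m N) (x : Gm m) :
    D m (a * M m N) x = (∑ b ∈ range a, rad m N x ^ b) * D m (M m N) x := by
  induction a with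
  | zero => simp [D]
  | succ a ih =>
    rw [add_mul, one_mul, D_add hm (by omega) le_rfl, ih (by omega), sum_range_succ]
    ring

lemma fejerSum_add (hm : ∀ k, 2 ≤ m k) {N a n : ℕ} (ha : a < m N) (hn : n ≤ M m N) (x : Gm m) :
    fejerSum m (a * M m N + n) x =
      fejerSum m (a * M m N) x + n * D m (a * M m N) x + rad m N x ^ a * fejerSum m n x := by
  rw [fejerSum, sum_range_add, fejerSum, fejerSum, mul_sum, add_assoc]
  congr 1
  have : ∀ i ∈ range n, D m (a * M m N + i + 1) x =
      D m (a * M m N) x + rad m N x ^ a * D m (i + 1) x := fun i hi =>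
    D_add hm ha (le_trans (Nat.succ_le_of_lt (by simpa using hi)) hn) x
  rw [sum_congr rfl this, sum_add_distrib]
  simp

lemma fejerSum_mul (hm : ∀ k, 2 ≤ m k) {N a : ℕ} (ha : a ≤ m N) (x : Gm m) :
    fejerSum m (a * M m N) x = (M m N : ℂ) * ∑ b ∈ range a, D m (b * M m N) x +
      (∑ b ∈ range a, rad m N x ^ b) * fejerSum m (M m N) x := by
  induction a with
  | zero => simp [fejerSum]
  | succ a ih =>
    rw [add_mul, one_mul, fejerSum_add hm (by omega) le_rfl, ih (by omega), sum_range_succ,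
      sum_range_succ]
    ring

lemma D_M (hm : ∀ k, 2 ≤ m k) (N : ℕ) (x : Gm m) :
    D m (M m N) x = (I m N).indicator (fun _ => (M m N : ℂ)) x := by
  induction N with
  | zero => simp [D, M, I, vil, digit]
  | succ N ih =>
    rw [M_succ, D_mul hm le_rfl, ih, geom_sum_rad hm]
    have h : x ∈ I m (N + 1) ↔ x N = 0 ∧ x ∈ I m N := by
      simp only [I, Set.mem_ofPred_eq, Nat.lt_succ_iff_lt_or_eq, or_imp, forall_and, forall_eq]
      exact and_comm
    by_cases h1 : x N = 0 <;> by_cases h2 : x ∈ I m N <;> simp [h, h1, h2]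

lemma norm_geom_sum_rad_le (hm : ∀ k, 2 ≤ m k) (N a : ℕ) (x : Gm m) :
    ‖∑ b ∈ range a, rad m N x ^ b‖ ≤ a := by
  refine (norm_sum_le _ _).trans ?_
  simp [norm_rad hm]

lemma norm_D_mul_le (hm : ∀ k, 2 ≤ m k) {N a : ℕ} (ha : a ≤ m N) (x : Gm m) :
    ‖D m (a * M m N) x‖ ≤ m N * ‖D m (M m N) x‖ := by
  rw [D_mul hm ha, norm_mul]
  exact mul_le_mul_of_nonneg_right
    ((norm_geom_sum_rad_le hm N a x).trans (by exact_mod_cast ha)) (norm_nonneg _)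

lemma norm_sum_D_mul_le (hm : ∀ k, 2 ≤ m k) {N a : ℕ} (ha : a ≤ m N) (x : Gm m) :
    ‖∑ b ∈ range a, D m (b * M m N) x‖ ≤ m N * (m N * ‖D m (M m N) x‖) := by
  refine (norm_sum_le_of_le _ fun b hb =>
    norm_D_mul_le hm (le_trans (le_of_lt (by simpa using hb)) ha) x).trans ?_
  rw [sum_const, card_range, nsmul_eq_mul]
  have : (a : ℝ) ≤ m N := by exact_mod_cast ha
  gcongr

/-- The points all of whose first `A` coordinates vanish, with the possible exception of the
coordinate `k`. -/
def axis (m : ℕ → ℕ) (k A : ℕ) : Set (Gm m) := {x | ∀ i < A, i ≠ k → x i = 0}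

/-- The weights `∑_{k ≤ A} M_k M_A 1_{axis k A}` that dominate `M_A |K_{M_A}|`. -/
def axisSum (m : ℕ → ℕ) (A : ℕ) (x : Gm m) : ℝ :=
  ∑ k ∈ range (A + 1), (M m k : ℝ) * M m A * (axis m k A).indicator 1 x

lemma axisSum_nonneg (A : ℕ) (x : Gm m) : 0 ≤ axisSum m A x :=
  sum_nonneg fun k _ => mul_nonneg (by positivity) (Set.indicator_nonneg (by simp) _)

lemma axis_self (A : ℕ) : axis m A A = I m A := by
  ext x
  exact forall₂_congr fun i hi => by simp [hi.ne]

lemma axis_self_succ (A : ℕ) : axis m A (A + 1) = I m A := by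
  ext x
  refine ⟨fun h i hi => h i (by omega) hi.ne, fun h i hi hne => h i (by omega)⟩

lemma M_mul_norm_D_le (hm : ∀ k, 2 ≤ m k) (A : ℕ) (x : Gm m) :
    (M m A : ℝ) * ‖D m (M m A) x‖ ≤ axisSum m A x := by
  rw [axisSum, sum_range_succ, D_M hm, axis_self]
  have : 0 ≤ ∑ k ∈ range A, (M m k : ℝ) * M m A * (axis m k A).indicator 1 x :=
    sum_nonneg fun k _ => mul_nonneg (by positivity) (Set.indicator_nonneg (by simp) _)
  by_cases h : x ∈ I m A <;> simp [h, this]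

lemma norm_fejerSum_M_le (hm : ∀ k, 2 ≤ m k) {lam : ℕ} (hl : ∀ k, m k ≤ lam) (A : ℕ)
    (x : Gm m) : ‖fejerSum m (M m A) x‖ ≤ (lam : ℝ) ^ 2 * axisSum m A x := by
  have hlam : (1 : ℝ) ≤ lam := by exact_mod_cast (by linarith [hm 0, hl 0] : 1 ≤ lam)
  induction A with
  | zero =>
    simp only [M, fejerSum, D, axisSum, axis, vil, digit]
    simpa [M] using (by exact_mod_cast hlam : 1 ≤ lam)
  | succ A ih =>
    rw [M_succ, fejerSum_mul hm le_rfl, geom_sum_rad hm]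
    have hmA : (m A : ℝ) ≤ lam := by exact_mod_cast hl A
    have h1 : ‖(M m A : ℂ) * ∑ b ∈ range (m A), D m (b * M m A) x‖ ≤
        (lam : ℝ) ^ 2 * (M m A * M m (A + 1) * (axis m A (A + 1)).indicator 1 x) := by
      rw [norm_mul, Complex.norm_natCast, axis_self_succ]
      calc (M m A : ℝ) * ‖∑ b ∈ range (m A), D m (b * M m A) x‖
          ≤ M m A * (m A * (m A * ‖D m (M m A) x‖)) := by
            gcongr
            exact norm_sum_D_mul_le hm le_rfl x
        _ ≤ M m A * (lam * (lam * ‖D m (M m A) x‖)) := by gcongr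
        _ = lam ^ 2 * (M m A * ‖D m (M m A) x‖) := by ring
        _ ≤ _ := by
            rw [D_M hm]
            have hM : (M m A : ℝ) ≤ M m (A + 1) := by exact_mod_cast M_mono hm A.le_succ
            by_cases h : x ∈ I m A
            · simp only [h, Set.indicator_of_mem, Complex.norm_natCast, Pi.one_apply, mul_one]
              gcongr
            · simp [h]
    have h2 : ‖(if x A = 0 then (m A : ℂ) else 0) * fejerSum m (M m A) x‖ ≤
        (lam : ℝ) ^ 2 * (∑ k ∈ range A, (M m k : ℝ) * M m (A + 1) *
          (axis m k (A + 1)).indicator 1 x +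
          M m (A + 1) * M m (A + 1) * (axis m (A + 1) (A + 1)).indicator 1 x) := by
      split_ifs with h0
      · rw [norm_mul, Complex.norm_natCast]
        refine (mul_le_mul_of_nonneg_left ih (by positivity)).trans ?_
        rw [axisSum, mul_left_comm]
        gcongr
        rw [sum_range_succ, mul_add, mul_sum]
        have hx : ∀ k, (axis m k A).indicator (1 : Gm m → ℝ) x ≤
            (axis m k (A + 1)).indicator 1 x := by
          intro k
          by_cases h : x ∈ axis m k A
          · have : x ∈ axis m k (A + 1) := by
              intro i hi hne
              rcases Nat.lt_succ_iff_lt_or_eq.mp hi with h' | rfl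
              · exact h i h' hne
              · exact h0
            simp [h, this]
          · rw [Set.indicator_of_notMem h]
            exact Set.indicator_nonneg (by simp) _
        refine add_le_add (sum_le_sum fun k _ => ?_) ?_
        · rw [M_succ]
          push_cast
          have := hx k
          calc (m A : ℝ) * (M m k * M m A * (axis m k A).indicator 1 x)
              = M m k * (m A * M m A) * (axis m k A).indicator 1 x := by ring
            _ ≤ _ := by gcongr
        · have hA : (axis m A A).indicator (1 : Gm m → ℝ) x ≤
              (axis m (A + 1) (A + 1)).indicator 1 x := by
            by_cases h : x ∈ axis m A A
            · have : x ∈ axis m (A + 1) (A + 1) := by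
                intro i hi hne
                rcases Nat.lt_succ_iff_lt_or_eq.mp hi with h' | rfl
                · exact h i h' h'.ne
                · exact h0
              simp [h, this]
            · rw [Set.indicator_of_notMem h]
              exact Set.indicator_nonneg (by simp) _
          have hM : (M m A : ℝ) ≤ M m (A + 1) := by exact_mod_cast M_mono hm A.le_succ
          calc (m A : ℝ) * (M m A * M m A * (axis m A A).indicator 1 x)
              = M m A * M m (A + 1) * (axis m A A).indicator 1 x := by
                rw [M_succ]
                push_cast
                ring
            _ ≤ _ := by
                have : 0 ≤ (axis m A A).indicator (1 : Gm m → ℝ) x :=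
                  Set.indicator_nonneg (by simp) _
                gcongr
      · rw [zero_mul, norm_zero]
        have h := axisSum_nonneg (A + 1) x
        have hi : ∀ k, 0 ≤ (axis m k (A + 1)).indicator (1 : Gm m → ℝ) x :=
          fun k => Set.indicator_nonneg (by simp) _
        exact mul_nonneg (by positivity) (add_nonneg (sum_nonneg fun k _ =>
          mul_nonneg (by positivity) (hi k)) (mul_nonneg (by positivity) (hi _)))
    refine (norm_add_le _ _).trans ((add_le_add h1 h2).trans (le_of_eq ?_))
    rw [axisSum, sum_range_succ, sum_range_succ]
    ring

lemma norm_fejerSum_le (hm : ∀ k, 2 ≤ m k) {lam : ℕ} (hl : ∀ k, m k ≤ lam) {N n : ℕ}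
    (hn : n < M m N) (x : Gm m) :
    ‖fejerSum m n x‖ ≤ 3 * (lam : ℝ) ^ 3 * ∑ A ∈ range N, axisSum m A x := by
  have hlam : (1 : ℝ) ≤ lam := by exact_mod_cast (by linarith [hm 0, hl 0] : 1 ≤ lam)
  induction N generalizing n with
  | zero =>
    have : n = 0 := by simpa [M] using hn
    simp [this, fejerSum]
  | succ N ih =>
    have hmN : (m N : ℝ) ≤ lam := by exact_mod_cast hl N
    obtain ⟨a, r, ha, hr, rfl⟩ : ∃ a r, a < m N ∧ r < M m N ∧ n = a * M m N + r :=
      ⟨n / M m N, n % M m N, Nat.div_lt_of_lt_mul (by rwa [mul_comm, ← M_succ]),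
        Nat.mod_lt _ (M_pos hm N), by rw [mul_comm]; exact (Nat.div_add_mod _ _).symm⟩
    have haN : (a : ℝ) ≤ m N := by exact_mod_cast ha.le
    have hrN : (r : ℝ) ≤ M m N := by exact_mod_cast hr.le
    rw [fejerSum_add hm ha hr.le, fejerSum_mul hm ha.le, sum_range_succ, mul_add]
    have hD := M_mul_norm_D_le hm N x
    have hF := norm_fejerSum_M_le hm hl N x
    have hS := axisSum_nonneg N x
    have h1 : ‖(M m N : ℂ) * ∑ b ∈ range a, D m (b * M m N) x‖ ≤ lam ^ 3 * axisSum m N x := by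
      rw [norm_mul, Complex.norm_natCast]
      calc (M m N : ℝ) * ‖∑ b ∈ range a, D m (b * M m N) x‖
          ≤ M m N * (m N * (m N * ‖D m (M m N) x‖)) := by
            gcongr
            exact norm_sum_D_mul_le hm ha.le x
        _ ≤ M m N * (lam * (lam * ‖D m (M m N) x‖)) := by gcongr
        _ = lam ^ 2 * (M m N * ‖D m (M m N) x‖) := by ring
        _ ≤ lam ^ 3 * axisSum m N x := by
          gcongr
          · norm_num
    have h2 : ‖(∑ b ∈ range a, rad m N x ^ b) * fejerSum m (M m N) x‖ ≤
        lam ^ 3 * axisSum m N x := by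
      rw [norm_mul]
      calc _ ≤ (lam : ℝ) * (lam ^ 2 * axisSum m N x) := by
            gcongr
            exact (norm_geom_sum_rad_le hm N a x).trans (haN.trans hmN)
        _ = _ := by ring
    have h3 : ‖(r : ℂ) * D m (a * M m N) x‖ ≤ lam ^ 3 * axisSum m N x := by
      rw [norm_mul, Complex.norm_natCast]
      calc (r : ℝ) * ‖D m (a * M m N) x‖ ≤ M m N * (m N * ‖D m (M m N) x‖) := by
            gcongr
            exact norm_D_mul_le hm ha.le x
        _ = m N * (M m N * ‖D m (M m N) x‖) := by ring
        _ ≤ lam * axisSum m N x := by gcongr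
        _ ≤ lam ^ 3 * axisSum m N x := by
          gcongr
          exact le_self_pow₀ hlam (by norm_num)
    have h4 : ‖rad m N x ^ a * fejerSum m r x‖ ≤
        3 * (lam : ℝ) ^ 3 * ∑ A ∈ range N, axisSum m A x := by
      rw [norm_mul, norm_pow, norm_rad hm, one_pow, one_mul]
      exact ih hr
    refine (norm_add_le _ _).trans ((add_le_add ((norm_add_le _ _).trans
      (add_le_add ((norm_add_le _ _).trans (add_le_add h1 h2)) h3)) h4).trans (le_of_eq ?_))
    ring

end Kernel

section Cylinders

variable {m : ℕ → ℕ} {μ : Measure (Gm m)}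

lemma measurableSet_cylAt (n : ℕ) (x : Gm m) : MeasurableSet (cylAt m n x) := by
  have : cylAt m n x = ⋂ k ∈ Set.Iio n, (fun y : Gm m => y k) ⁻¹' {x k} := by
    ext y
    simp [cylAt]
  rw [this]
  exact MeasurableSet.biInter (Set.to_countable _) fun k _ =>
    measurable_pi_apply k MeasurableSpace.measurableSet_top

lemma countable_zmod (n : ℕ) : Countable (ZMod n) := by
  cases n
  · exact inferInstanceAs (Countable ℤ)
  · infer_instance

lemma measurableSingletonClass_zmod (n : ℕ) : MeasurableSingletonClass (ZMod n) :=
  ⟨fun _ => MeasurableSpace.measurableSet_top⟩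

lemma measurableSet_eq_coord (i : ℕ) : MeasurableSet {p : Gm m × Gm m | p.2 i = p.1 i} :=
  have := countable_zmod (m i)
  have := measurableSingletonClass_zmod (m i)
  measurableSet_eq_fun ((measurable_pi_apply i).comp measurable_snd)
    ((measurable_pi_apply i).comp measurable_fst)

lemma measurableSet_mem_cylAt (A : ℕ) :
    MeasurableSet {p : Gm m × Gm m | p.2 ∈ cylAt m A p.1} := by
  have : {p : Gm m × Gm m | p.2 ∈ cylAt m A p.1} =
      ⋂ i ∈ Set.Iio A, {p : Gm m × Gm m | p.2 i = p.1 i} := by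
    ext y
    simp [cylAt]
  rw [this]
  exact MeasurableSet.biInter (Set.to_countable _) fun i _ => measurableSet_eq_coord i

lemma measurableSet_mem_cylAt_update (k A : ℕ) (a : ZMod (m k)) :
    MeasurableSet {p : Gm m × Gm m | p.2 ∈ cylAt m A (Function.update p.1 k a)} := by
  have : Measurable fun p : Gm m × Gm m => (Function.update p.1 k a, p.2) :=
    (measurable_update_left.comp measurable_fst).prodMk measurable_snd
  exact (measurableSet_mem_cylAt A).preimage this

lemma measurable_of_dependsOn {β : Type*} [MeasurableSpace β] {j : ℕ} {g : Gm m → β}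
    (hg : DependsOn g (Set.Iio j)) : Measurable g := by
  have (i : ℕ) := countable_zmod (m i)
  have (i : ℕ) := measurableSingletonClass_zmod (m i)
  let e : (∀ i : Fin j, ZMod (m i)) → Gm m := fun v i => if h : i < j then v ⟨i, h⟩ else 0
  have h1 : g = (fun v => g (e v)) ∘ fun (x : Gm m) (i : Fin j) => x i := by
    funext x
    refine hg fun i hi => ?_
    have : i < j := hi
    simp [e, this]
  rw [h1]
  exact (measurable_of_countable _).comp (measurable_pi_lambda _ fun i => measurable_pi_apply _)

lemma mem_cylAt_comm {n : ℕ} {x y : Gm m} : x ∈ cylAt m n y ↔ y ∈ cylAt m n x :=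
  forall₂_congr fun _ _ => eq_comm

lemma cylAt_subset_of_mem {A j : ℕ} (h : A ≤ j) {x t : Gm m} (ht : t ∈ cylAt m A x) :
    cylAt m j t ⊆ cylAt m A x :=
  fun _ hs i hi => (hs i (hi.trans_le h)).trans (ht i hi)

lemma IsHaar.isProbabilityMeasure (h : IsHaar m μ) : IsProbabilityMeasure μ := by
  refine ⟨?_⟩
  have := h 0 0
  simpa [cylAt, M] using this

lemma M_ne_zero (hm : ∀ k, 2 ≤ m k) (k : ℕ) : (M m k : ℝ≥0∞) ≠ 0 := by
  exact_mod_cast (M_pos hm k).ne'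

lemma setLIntegral_cylAt (h : IsHaar m μ) {j A : ℕ} (hj : j ≤ A) {g : Gm m → ℝ≥0∞}
    (hg : DependsOn g (Set.Iio j)) (y : Gm m) :
    ∫⁻ t in cylAt m A y, g t ∂μ = g y * (M m A : ℝ≥0∞)⁻¹ := by
  rw [setLIntegral_congr_fun (g := fun _ => g y) (measurableSet_cylAt A y)
    fun t ht => hg fun i hi => ht i (lt_of_lt_of_le hi hj)]
  rw [setLIntegral_const, h]

/-- The integral of `g` over the cylinder of length `A` around `x` with its `k`-th coordinate
replaced by `a`. -/
def shiftInt (μ : Measure (Gm m)) (k A : ℕ) (a : ZMod (m k)) (g : Gm m → ℝ≥0∞) (x : Gm m) :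
    ℝ≥0∞ :=
  ∫⁻ t in cylAt m A (Function.update x k a), g t ∂μ

lemma dependsOn_shiftInt (k A : ℕ) (a : ZMod (m k)) (g : Gm m → ℝ≥0∞) :
    DependsOn (shiftInt μ k A a g) (Set.Iio A) := by
  intro x y h
  have : cylAt m A (Function.update x k a) = cylAt m A (Function.update y k a) := by
    ext t
    refine forall₂_congr fun i hi => ?_
    by_cases hik : i = k
    · subst hik
      simp
    · simp [Function.update_of_ne hik, h i hi]
  rw [shiftInt, shiftInt, this]

lemma lintegral_shiftInt_le (hm : ∀ k, 2 ≤ m k) {lam : ℕ} (hl : ∀ k, m k ≤ lam)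
    (h : IsHaar m μ) (k A : ℕ) (a : ZMod (m k)) {g : Gm m → ℝ≥0∞} (hg : Measurable g) :
    ∫⁻ x, shiftInt μ k A a g x ∂μ ≤ lam * (M m A : ℝ≥0∞)⁻¹ * ∫⁻ t, g t ∂μ := by
  have := h.isProbabilityMeasure
  have := neZero_of_two_le hm
  have hms := measurableSet_mem_cylAt_update k A a
  have hmeas (t : Gm m) : MeasurableSet {x : Gm m | t ∈ cylAt m A (Function.update x k a)} :=
    hms.preimage (measurable_id.prodMk measurable_const)
  have h1 (t : Gm m) : μ {x : Gm m | t ∈ cylAt m A (Function.update x k a)} ≤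
      lam * (M m A : ℝ≥0∞)⁻¹ := by
    have hsub : {x : Gm m | t ∈ cylAt m A (Function.update x k a)} ⊆
        ⋃ b : ZMod (m k), cylAt m A (Function.update t k b) := by
      intro x hx
      refine Set.mem_iUnion.mpr ⟨x k, fun i hi => ?_⟩
      by_cases hik : i = k
      · subst hik
        simp
      · simpa [Function.update_of_ne hik] using (hx i hi).symm
    calc _ ≤ ∑ b : ZMod (m k), μ (cylAt m A (Function.update t k b)) :=
          (measure_mono hsub).trans (measure_iUnion_fintype_le _ _)
      _ = m k * (M m A : ℝ≥0∞)⁻¹ := by simp [h A, ZMod.card]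
      _ ≤ _ := by
          have := hl k
          gcongr
  calc ∫⁻ x, shiftInt μ k A a g x ∂μ
      = ∫⁻ x, ∫⁻ t, {p : Gm m × Gm m | p.2 ∈ cylAt m A (Function.update p.1 k a)}.indicator
          (fun p => g p.2) (x, t) ∂μ ∂μ := by
        refine lintegral_congr fun x => ?_
        rw [shiftInt, ← lintegral_indicator (measurableSet_cylAt _ _)]
        rfl
    _ = ∫⁻ t, ∫⁻ x, {p : Gm m × Gm m | p.2 ∈ cylAt m A (Function.update p.1 k a)}.indicator
          (fun p => g p.2) (x, t) ∂μ ∂μ :=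
        lintegral_lintegral_swap ((hg.comp measurable_snd).indicator hms).aemeasurable
    _ = ∫⁻ t, g t * μ {x : Gm m | t ∈ cylAt m A (Function.update x k a)} ∂μ := by
        refine lintegral_congr fun t => ?_
        rw [← setLIntegral_const, ← lintegral_indicator (hmeas t)]
        rfl
    _ ≤ ∫⁻ t, lam * (M m A : ℝ≥0∞)⁻¹ * g t ∂μ :=
        lintegral_mono fun t => by
          rw [mul_comm]
          gcongr
          exact h1 t
    _ = _ := lintegral_const_mul _ hg

lemma rpow_half_mul_self (x : ℝ≥0∞) : x ^ (1 / 2 : ℝ) * x ^ (1 / 2 : ℝ) = x := by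
  rw [← ENNReal.rpow_add_of_nonneg _ _ (by norm_num) (by norm_num)]
  norm_num

lemma rpow_half_le_of_le_mul_self {x y : ℝ≥0∞} (h : x ≤ y * y) : x ^ (1 / 2 : ℝ) ≤ y := by
  calc x ^ (1 / 2 : ℝ) ≤ (y * y) ^ (1 / 2 : ℝ) := by gcongr
    _ = y := by
      rw [ENNReal.mul_rpow_of_nonneg _ _ (by norm_num), rpow_half_mul_self]

lemma shiftInt_rpow_half_le (hm : ∀ k, 2 ≤ m k) (h : IsHaar m μ) {j k A : ℕ} (hA : A ≤ j)
    (a : ZMod (m k)) {g : Gm m → ℝ≥0∞} (hg : DependsOn g (Set.Iio j)) (x : Gm m) :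
    shiftInt μ k A a g x ^ (1 / 2 : ℝ) ≤
      (M m j : ℝ≥0∞) ^ (1 / 2 : ℝ) * shiftInt μ k A a (fun t => g t ^ (1 / 2 : ℝ)) x := by
  have hg' : DependsOn (fun t => g t ^ (1 / 2 : ℝ)) (Set.Iio j) := fun x y hxy => by
    simp only [hg hxy]
  have hM := M_ne_zero hm j
  refine rpow_half_le_of_le_mul_self ?_
  rw [mul_mul_mul_comm, rpow_half_mul_self]
  set y := Function.update x k a
  have h1 : ∀ t ∈ cylAt m A y, g t ^ (1 / 2 : ℝ) ≤
      M m j * ∫⁻ s in cylAt m A y, g s ^ (1 / 2 : ℝ) ∂μ := by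
    intro t ht
    calc g t ^ (1 / 2 : ℝ) = M m j * (g t ^ (1 / 2 : ℝ) * (M m j : ℝ≥0∞)⁻¹) := by
          rw [mul_left_comm, ENNReal.mul_inv_cancel hM (ENNReal.natCast_ne_top _), mul_one]
      _ = M m j * ∫⁻ s in cylAt m j t, g s ^ (1 / 2 : ℝ) ∂μ := by
          rw [setLIntegral_cylAt h le_rfl hg']
      _ ≤ _ := by
          gcongr
          exact cylAt_subset_of_mem hA ht
  calc shiftInt μ k A a g x
      = ∫⁻ t in cylAt m A y, g t ^ (1 / 2 : ℝ) * g t ^ (1 / 2 : ℝ) ∂μ := by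
        simp only [rpow_half_mul_self]
        rfl
    _ ≤ ∫⁻ t in cylAt m A y, (M m j * ∫⁻ s in cylAt m A y, g s ^ (1 / 2 : ℝ) ∂μ) *
          g t ^ (1 / 2 : ℝ) ∂μ :=
        setLIntegral_mono' (measurableSet_cylAt _ _) fun t ht => by
          gcongr
          exact h1 t ht
    _ = _ := by
        rw [lintegral_const_mul _ (measurable_of_dependsOn hg')]
        simp only [shiftInt, y]
        ring

lemma dependsOn_vil (hm : ∀ k, 2 ≤ m k) {n N : ℕ} (hn : n < M m N) :
    DependsOn (vil m n) (Set.Iio N) := by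
  intro x y h
  rw [vil_eq_prod hm hn, vil_eq_prod hm hn]
  refine prod_congr rfl fun k hk => ?_
  have : x k = y k := h k (by simpa using hk)
  simp only [rad, this]

lemma IsMartingale.dependsOn {f : ℕ → Gm m → ℂ} (hf : IsMartingale m μ f) (n : ℕ) :
    DependsOn (f n) (Set.Iio n) :=
  fun x y h => hf.adapted n x y fun k hk => h k hk

lemma IsMartingale.integral_mul_eq (hm : ∀ k, 2 ≤ m k) (h : IsHaar m μ) {f : ℕ → Gm m → ℂ}
    (hf : IsMartingale m μ f) {N P : ℕ} (hNP : N ≤ P) {g : Gm m → ℂ}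
    (hg : DependsOn g (Set.Iio N)) (hb : ∀ x, ‖g x‖ ≤ 1) :
    ∫ x, f N x * g x ∂μ = ∫ x, f P x * g x ∂μ := by
  have := h.isProbabilityMeasure
  have hM : (M m N : ℂ) ≠ 0 := by exact_mod_cast (M_pos hm N).ne'
  have hgm := measurable_of_dependsOn hg
  have hgi : Integrable g μ :=
    Integrable.of_bound hgm.aestronglyMeasurable 1 (Filter.Eventually.of_forall hb)
  set s : Set (Gm m × Gm m) := {p | p.2 ∈ cylAt m N p.1}
  have hms : MeasurableSet s := measurableSet_mem_cylAt N
  have hint : Integrable (s.indicator fun p => g p.1 * f P p.2) (μ.prod μ) :=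
    (hgi.mul_prod (hf.integrable P)).indicator hms
  calc ∫ x, f N x * g x ∂μ
      = (M m N : ℂ) * ∫ x, ∫ t, s.indicator (fun p => g p.1 * f P p.2) (x, t) ∂μ ∂μ := by
        rw [← integral_const_mul]
        refine integral_congr_ae (Filter.Eventually.of_forall fun x => ?_)
        have : (fun t => s.indicator (fun p => g p.1 * f P p.2) (x, t)) =
            (cylAt m N x).indicator fun t => g x * f P t := rfl
        simp only [this]
        rw [integral_indicator (measurableSet_cylAt _ _), integral_const_mul, hf.mart N P hNP x]
        ring
    _ = (M m N : ℂ) * ∫ t, ∫ x, s.indicator (fun p => g p.1 * f P p.2) (x, t) ∂μ ∂μ := by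
        rw [integral_integral_swap (f := fun x t => s.indicator (fun p => g p.1 * f P p.2) (x, t)) hint]
    _ = ∫ x, f P x * g x ∂μ := by
        rw [← integral_const_mul]
        refine integral_congr_ae (Filter.Eventually.of_forall fun t => ?_)
        have h1 : (fun x => s.indicator (fun p => g p.1 * f P p.2) (x, t)) =
            (cylAt m N t).indicator fun x => g t * f P t := by
          funext x
          by_cases hx : t ∈ cylAt m N x
          · rw [Set.indicator_of_mem (show (x, t) ∈ s from hx),
              Set.indicator_of_mem (mem_cylAt_comm.mp hx), hg fun i hi => (hx i hi).symm]
          · rw [Set.indicator_of_notMem (show (x, t) ∉ s from hx),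
              Set.indicator_of_notMem fun h' => hx (mem_cylAt_comm.mp h')]
        simp only [h1]
        rw [integral_indicator (measurableSet_cylAt _ _), setIntegral_const, Measure.real, h]
        simp
        field_simp

lemma IsMartingale.coeff_eq (hm : ∀ k, 2 ≤ m k) (h : IsHaar m μ) {f : ℕ → Gm m → ℂ}
    (hf : IsMartingale m μ f) {i N : ℕ} (hi : i < M m N) :
    coeff m μ f i = ∫ x, f N x * (starRingEnd ℂ) (vil m i x) ∂μ := by
  have hi' : i < M m (i + 1) := i.lt_succ_self.trans (lt_M_self hm _)
  have hb (x : Gm m) : ‖(starRingEnd ℂ) (vil m i x)‖ ≤ 1 := by simp [norm_vil hm]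
  have hd {L : ℕ} (hL : i < M m L) :
      DependsOn (fun x => (starRingEnd ℂ) (vil m i x)) (Set.Iio L) := fun x y hxy => by
    simp only [dependsOn_vil hm hL hxy]
  rcases le_total N (i + 1) with hN | hN
  · exact (hf.integral_mul_eq hm h hN (hd hi) hb).symm
  · exact hf.integral_mul_eq hm h hN (hd hi') hb

lemma IsMartingale.sigma_eq (hm : ∀ k, 2 ≤ m k) (h : IsHaar m μ) {f : ℕ → Gm m → ℂ}
    (hf : IsMartingale m μ f) {n N : ℕ} (hn : n < M m N) (x : Gm m) :
    sigma m μ f n x = (n : ℂ)⁻¹ * ∫ t, f N t * fejerSum m n (x - t) ∂μ := by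
  have hint {i : ℕ} (hi : i < M m N) : Integrable (fun t => f N t * vil m i (x - t)) μ := by
    have hd : DependsOn (fun t => vil m i (x - t)) (Set.Iio N) := fun s t hst =>
      dependsOn_vil hm hi fun k hk => by simp [hst k hk]
    exact (hf.integrable N).mul_bdd (c := 1)
      (measurable_of_dependsOn hd).aestronglyMeasurable
      (Filter.Eventually.of_forall fun t => (norm_vil hm _ _).le)
  rw [sigma]
  congr 1
  simp only [fejerSum, D, mul_sum]
  have hlt {k i : ℕ} (hk : k ∈ range n) (hi : i ∈ range (k + 1)) : i < M m N := by
    simp only [mem_range] at hk hi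
    omega
  rw [integral_finsetSum _ fun k hk => integrable_finsetSum _ fun i hi => hint (hlt hk hi)]
  refine sum_congr rfl fun k hk => ?_
  rw [integral_finsetSum _ fun i hi => hint (hlt hk hi), S]
  refine sum_congr rfl fun i hi => ?_
  rw [hf.coeff_eq hm h (hlt hk hi), ← integral_mul_const]
  refine integral_congr_ae (Filter.Eventually.of_forall fun t => ?_)
  simp only [← vil_mul_conj hm]
  ring

end Cylinders

section Jumps

/-- The running record of a sequence `F`: it changes, to the current value of `F`, only when `F`
exceeds twice the previous record. -/
def record (F : ℕ → ℝ≥0∞) : ℕ → ℝ≥0∞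
  | 0 => F 0
  | n + 1 => if 2 * record F n < F (n + 1) then F (n + 1) else record F n

/-- The value of the record of `F` at the times where it changes, and zero elsewhere. -/
def jump (F : ℕ → ℝ≥0∞) : ℕ → ℝ≥0∞
  | 0 => F 0
  | n + 1 => if 2 * record F n < F (n + 1) then F (n + 1) else 0

lemma record_congr {F F' : ℕ → ℝ≥0∞} {n : ℕ} (h : ∀ i ≤ n, F i = F' i) :
    record F n = record F' n := by
  induction n with
  | zero => exact h 0 le_rfl
  | succ n ih => rw [record, record, ih fun i hi => h i (by omega), h (n + 1) le_rfl]

lemma jump_congr {F F' : ℕ → ℝ≥0∞} {n : ℕ} (h : ∀ i ≤ n, F i = F' i) :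
    jump F n = jump F' n := by
  cases n with
  | zero => exact h 0 le_rfl
  | succ n =>
    rw [jump, jump, record_congr fun i hi => h i (by omega), h (n + 1) le_rfl]

lemma le_two_mul_record (F : ℕ → ℝ≥0∞) (n : ℕ) : F n ≤ 2 * record F n := by
  cases n with
  | zero => exact le_mul_of_one_le_left' (by norm_num)
  | succ n =>
    rw [record]
    split_ifs with h
    · exact le_mul_of_one_le_left' (by norm_num)
    · exact not_lt.mp h

lemma record_le_iSup (F : ℕ → ℝ≥0∞) (n : ℕ) : record F n ≤ ⨆ i, F i := by
  induction n with
  | zero => exact le_iSup F 0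
  | succ n ih =>
    rw [record]
    split_ifs
    · exact le_iSup F (n + 1)
    · exact ih

lemma record_le_sum_jump (F : ℕ → ℝ≥0∞) (n : ℕ) :
    record F n ≤ ∑ j ∈ range (n + 1), jump F j := by
  induction n with
  | zero => simp [record, jump]
  | succ n ih =>
    rw [sum_range_succ, record, jump]
    split_ifs
    · exact le_add_self
    · simpa using ih

lemma four_mul_rpow_half_add_le {x y : ℝ≥0∞} (h : 2 * x ≤ y) :
    4 * x ^ (1 / 2 : ℝ) + y ^ (1 / 2 : ℝ) ≤ 4 * y ^ (1 / 2 : ℝ) := by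
  have h1 : 4 * x ^ (1 / 2 : ℝ) ≤ 3 * y ^ (1 / 2 : ℝ) := by
    have h4 : (4 : ℝ≥0∞) = 16 ^ (1 / 2 : ℝ) := by
      rw [show (16 : ℝ≥0∞) = 4 * 4 by norm_num, ENNReal.mul_rpow_of_nonneg _ _ (by norm_num),
        rpow_half_mul_self]
    have h3 : (3 : ℝ≥0∞) = 9 ^ (1 / 2 : ℝ) := by
      rw [show (9 : ℝ≥0∞) = 3 * 3 by norm_num, ENNReal.mul_rpow_of_nonneg _ _ (by norm_num),
        rpow_half_mul_self]
    rw [h4, h3, ← ENNReal.mul_rpow_of_nonneg _ _ (by norm_num),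
      ← ENNReal.mul_rpow_of_nonneg _ _ (by norm_num)]
    refine ENNReal.rpow_le_rpow ?_ (by norm_num)
    calc 16 * x = 8 * (2 * x) := by ring
      _ ≤ 9 * y := by
        gcongr
        norm_num
  calc _ ≤ 3 * y ^ (1 / 2 : ℝ) + y ^ (1 / 2 : ℝ) := by gcongr
    _ = _ := by ring

lemma sum_jump_rpow_half_le (F : ℕ → ℝ≥0∞) (n : ℕ) :
    ∑ j ∈ range (n + 1), jump F j ^ (1 / 2 : ℝ) ≤ 4 * record F n ^ (1 / 2 : ℝ) := by
  induction n with
  | zero => simpa [record, jump] using le_mul_of_one_le_left' (by norm_num)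
  | succ n ih =>
    rw [sum_range_succ, record, jump]
    split_ifs with h
    · calc _ ≤ 4 * record F n ^ (1 / 2 : ℝ) + F (n + 1) ^ (1 / 2 : ℝ) := by gcongr
        _ ≤ _ := four_mul_rpow_half_add_le h.le
    · simpa using ih

lemma tsum_jump_rpow_half_le (F : ℕ → ℝ≥0∞) :
    ∑' j, jump F j ^ (1 / 2 : ℝ) ≤ 4 * (⨆ i, F i) ^ (1 / 2 : ℝ) := by
  refine ENNReal.tsum_le_of_sum_range_le fun n => ?_
  calc _ ≤ ∑ j ∈ range (n + 1), jump F j ^ (1 / 2 : ℝ) :=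
        sum_le_sum_of_subset (range_mono n.le_succ)
    _ ≤ 4 * record F n ^ (1 / 2 : ℝ) := sum_jump_rpow_half_le F n
    _ ≤ _ := by
      gcongr
      exact record_le_iSup F n

lemma le_two_mul_sum_jump (F : ℕ → ℝ≥0∞) (n : ℕ) :
    F n ≤ 2 * ∑ j ∈ range (n + 1), jump F j :=
  (le_two_mul_record F n).trans (by gcongr; exact record_le_sum_jump F n)

lemma sum_rpow_half_le {ι : Type*} (s : Finset ι) (f : ι → ℝ≥0∞) :
    (∑ i ∈ s, f i) ^ (1 / 2 : ℝ) ≤ ∑ i ∈ s, f i ^ (1 / 2 : ℝ) :=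
  Finset.le_sum_of_subadditive (fun x : ℝ≥0∞ => x ^ (1 / 2 : ℝ)) (by simp)
    (fun x y => ENNReal.rpow_add_le_add_rpow x y (by norm_num) (by norm_num)) s f

end Jumps

section Majorant

variable {m : ℕ → ℕ} {μ : Measure (Gm m)}

lemma sum_M_le (hm : ∀ k, 2 ≤ m k) (A : ℕ) : ∑ k ∈ range (A + 1), M m k ≤ 2 * M m A := by
  induction A with
  | zero => simp [M]
  | succ A ih =>
    have := two_mul_M_le hm A
    rw [sum_range_succ]
    omega

lemma sum_M_rpow_half_le (hm : ∀ k, 2 ≤ m k) (A : ℕ) :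
    ∑ k ∈ range (A + 1), (M m k : ℝ≥0∞) ^ (1 / 2 : ℝ) ≤ 4 * (M m A : ℝ≥0∞) ^ (1 / 2 : ℝ) := by
  induction A with
  | zero => simpa using le_mul_of_one_le_left' (by norm_num)
  | succ A ih =>
    rw [sum_range_succ]
    exact (add_le_add ih le_rfl).trans
      (four_mul_rpow_half_add_le (by exact_mod_cast two_mul_M_le hm A))

variable [∀ k, NeZero (m k)]

/-- A positive operator dominating the convolution of `g` with `M_A |K_{M_A}|`. -/
def layer (μ : Measure (Gm m)) (A : ℕ) (g : Gm m → ℝ≥0∞) (x : Gm m) : ℝ≥0∞ :=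
  ∑ k ∈ range (A + 1), ∑ a : ZMod (m k), (M m k : ℝ≥0∞) * M m A * shiftInt μ k A a g x

/-- A positive operator dominating the convolution of `g` with `n |K_n|` for all `n < M_N`. -/
def fejerMaj (μ : Measure (Gm m)) (N : ℕ) (g : Gm m → ℝ≥0∞) (x : Gm m) : ℝ≥0∞ :=
  ∑ A ∈ range (N + 1), layer μ A g x

lemma fejerMaj_le_two_mul_sum {N : ℕ} {ι : Type*} {s : Finset ι} {g : Gm m → ℝ≥0∞}
    {G : ι → Gm m → ℝ≥0∞} (hG : ∀ i ∈ s, Measurable (G i)) (h : ∀ t, g t ≤ 2 * ∑ i ∈ s, G i t)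
    (x : Gm m) : fejerMaj μ N g x ≤ 2 * ∑ i ∈ s, fejerMaj μ N (G i) x := by
  have h1 (k A : ℕ) (a : ZMod (m k)) :
      shiftInt μ k A a g x ≤ 2 * ∑ i ∈ s, shiftInt μ k A a (G i) x := by
    simp only [shiftInt]
    rw [← lintegral_finsetSum' _ fun i hi => (hG i hi).aemeasurable,
      ← lintegral_const_mul _ (Finset.measurable_fun_sum _ hG)]
    exact lintegral_mono fun t => h t
  have h2 : 2 * ∑ i ∈ s, fejerMaj μ N (G i) x =
      ∑ A ∈ range (N + 1), ∑ k ∈ range (A + 1), ∑ a : ZMod (m k),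
        (M m k : ℝ≥0∞) * M m A * (2 * ∑ i ∈ s, shiftInt μ k A a (G i) x) := by
    simp only [fejerMaj, layer]
    rw [sum_comm, mul_sum]
    refine sum_congr rfl fun A _ => ?_
    rw [sum_comm, mul_sum]
    refine sum_congr rfl fun k _ => ?_
    rw [sum_comm, mul_sum]
    refine sum_congr rfl fun a _ => ?_
    rw [← mul_sum, mul_left_comm]
  rw [h2]
  simp only [fejerMaj, layer]
  gcongr
  exact h1 _ _ _

lemma layer_le (hm : ∀ k, 2 ≤ m k) {lam : ℕ} (hl : ∀ k, m k ≤ lam) (h : IsHaar m μ) {j A : ℕ}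
    (hj : j ≤ A) {g : Gm m → ℝ≥0∞} (hg : DependsOn g (Set.Iio j)) (x : Gm m) :
    layer μ A g x ≤ layer μ j g x + 2 * lam * M m A * g x := by
  have hval {k B : ℕ} (hB : j ≤ B) (a : ZMod (m k)) :
      (M m k : ℝ≥0∞) * M m B * shiftInt μ k B a g x = M m k * g (Function.update x k a) := by
    rw [shiftInt, setLIntegral_cylAt h hB hg, mul_mul_mul_comm,
      ENNReal.mul_inv_cancel (M_ne_zero hm B) (ENNReal.natCast_ne_top _), mul_one]
  rw [layer, range_eq_Ico, ← sum_Ico_consecutive _ (Nat.zero_le j) (hj.trans A.le_succ)]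
  refine add_le_add ?_ ?_
  · calc _ = ∑ k ∈ Ico 0 j, ∑ a : ZMod (m k),
          (M m k : ℝ≥0∞) * M m j * shiftInt μ k j a g x := by
          simp only [hval hj, hval le_rfl]
      _ ≤ _ := by
          rw [layer, range_eq_Ico]
          exact sum_le_sum_of_subset (Ico_subset_Ico_right j.le_succ)
  · calc _ ≤ ∑ k ∈ Ico j (A + 1), lam * (M m k : ℝ≥0∞) * g x := by
          refine sum_le_sum fun k hk => ?_
          have hu (a : ZMod (m k)) : g (Function.update x k a) = g x := hg fun i hi => by
            have h1 : i < j := hi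
            have h2 := (mem_Ico.mp hk).1
            rw [Function.update_of_ne (by omega)]
          simp only [hval hj, hu, sum_const, card_univ, ZMod.card, nsmul_eq_mul]
          rw [← mul_assoc]
          have := hl k
          gcongr
      _ ≤ ∑ k ∈ range (A + 1), lam * (M m k : ℝ≥0∞) * g x := by
          rw [range_eq_Ico]
          exact sum_le_sum_of_subset (Ico_subset_Ico_left (Nat.zero_le j))
      _ = lam * ((∑ k ∈ range (A + 1), M m k : ℕ) : ℝ≥0∞) * g x := by
          rw [← sum_mul, ← mul_sum, Nat.cast_sum]
      _ ≤ lam * ((2 * M m A : ℕ) : ℝ≥0∞) * g x := by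
          have := sum_M_le hm A
          gcongr
      _ = _ := by
          push_cast
          ring

lemma fejerMaj_le (hm : ∀ k, 2 ≤ m k) {lam : ℕ} (hl : ∀ k, m k ≤ lam) (h : IsHaar m μ) {j N : ℕ}
    (hj : j ≤ N) {g : Gm m → ℝ≥0∞} (hg : DependsOn g (Set.Iio j)) (x : Gm m) :
    fejerMaj μ N g x ≤
      M m N * ((M m j : ℝ≥0∞)⁻¹ * fejerMaj μ j g x + 4 * lam * g x) := by
  have h1 : (1 : ℝ≥0∞) = (M m j : ℝ≥0∞) * (M m j : ℝ≥0∞)⁻¹ :=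
    (ENNReal.mul_inv_cancel (M_ne_zero hm j) (ENNReal.natCast_ne_top _)).symm
  induction N, hj using Nat.le_induction with
  | base =>
    rw [mul_add, ← mul_assoc, ← h1, one_mul]
    exact le_self_add
  | succ N hN ih =>
    set Q := fejerMaj μ j g x
    have hlayer : layer μ j g x ≤ M m N * ((M m j : ℝ≥0∞)⁻¹ * Q) := by
      calc layer μ j g x ≤ Q :=
            single_le_sum (f := fun A => layer μ A g x) (fun _ _ => zero_le) (self_mem_range_succ j)
        _ = M m j * ((M m j : ℝ≥0∞)⁻¹ * Q) := by rw [← mul_assoc, ← h1, one_mul]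
        _ ≤ _ := by
          have := M_mono hm hN
          gcongr
    have hM : 2 * (M m N : ℝ≥0∞) ≤ M m (N + 1) := by exact_mod_cast two_mul_M_le hm N
    rw [fejerMaj, sum_range_succ, ← fejerMaj]
    calc _ ≤ M m N * ((M m j : ℝ≥0∞)⁻¹ * Q + 4 * lam * g x) +
          (M m N * ((M m j : ℝ≥0∞)⁻¹ * Q) + 2 * lam * M m (N + 1) * g x) := by
          refine add_le_add ih ((layer_le hm hl h (hN.trans N.le_succ) hg x).trans ?_)
          gcongr
      _ = 2 * M m N * ((M m j : ℝ≥0∞)⁻¹ * Q + 2 * lam * g x) + 2 * lam * M m (N + 1) * g x := by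
          ring
      _ ≤ M m (N + 1) * ((M m j : ℝ≥0∞)⁻¹ * Q + 2 * lam * g x) +
          2 * lam * M m (N + 1) * g x := by gcongr
      _ = _ := by ring

lemma measurable_fejerMaj (N : ℕ) (g : Gm m → ℝ≥0∞) : Measurable (fejerMaj μ N g) := by
  unfold fejerMaj layer
  refine Finset.measurable_fun_sum _ fun A _ => Finset.measurable_fun_sum _ fun k _ =>
    Finset.measurable_fun_sum _ fun a _ => ?_
  exact (measurable_of_dependsOn (dependsOn_shiftInt k A a g)).const_mul _

lemma lintegral_layer_rpow_half_le (hm : ∀ k, 2 ≤ m k) {lam : ℕ} (hl : ∀ k, m k ≤ lam)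
    (h : IsHaar m μ) {j A : ℕ} (hA : A ≤ j) {g : Gm m → ℝ≥0∞} (hg : DependsOn g (Set.Iio j)) :
    ∫⁻ x, layer μ A g x ^ (1 / 2 : ℝ) ∂μ ≤
      4 * lam ^ 2 * (M m j : ℝ≥0∞) ^ (1 / 2 : ℝ) * ∫⁻ x, g x ^ (1 / 2 : ℝ) ∂μ := by
  set c : ℕ → ℝ≥0∞ := fun k => (M m k : ℝ≥0∞) ^ (1 / 2 : ℝ)
  have hc (k : ℕ) : c k * c k = M m k := rpow_half_mul_self _
  set J := ∫⁻ x, g x ^ (1 / 2 : ℝ) ∂μ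
  have hg' : DependsOn (fun t => g t ^ (1 / 2 : ℝ)) (Set.Iio j) := fun x y hxy => by
    simp only [hg hxy]
  have hmeas (k : ℕ) (a : ZMod (m k)) :
      Measurable (shiftInt μ k A a fun t => g t ^ (1 / 2 : ℝ)) :=
    measurable_of_dependsOn (dependsOn_shiftInt k A a _)
  calc ∫⁻ x, layer μ A g x ^ (1 / 2 : ℝ) ∂μ
      ≤ ∫⁻ x, ∑ k ∈ range (A + 1), ∑ a : ZMod (m k),
          c k * c A * c j * shiftInt μ k A a (fun t => g t ^ (1 / 2 : ℝ)) x ∂μ := by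
        refine lintegral_mono fun x => (sum_rpow_half_le _ _).trans ?_
        refine sum_le_sum fun k _ => (sum_rpow_half_le _ _).trans (sum_le_sum fun a _ => ?_)
        rw [ENNReal.mul_rpow_of_nonneg _ _ (by norm_num),
          ENNReal.mul_rpow_of_nonneg _ _ (by norm_num), mul_assoc (c k * c A)]
        gcongr
        exact shiftInt_rpow_half_le hm h hA a hg x
    _ = ∑ k ∈ range (A + 1), ∑ a : ZMod (m k),
          c k * c A * c j * ∫⁻ x, shiftInt μ k A a (fun t => g t ^ (1 / 2 : ℝ)) x ∂μ := by
        rw [lintegral_finsetSum _ fun k _ => Finset.measurable_fun_sum _ fun a _ =>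
          (hmeas k a).const_mul _]
        refine sum_congr rfl fun k _ => ?_
        rw [lintegral_finsetSum _ fun a _ => (hmeas k a).const_mul _]
        exact sum_congr rfl fun a _ => lintegral_const_mul _ (hmeas k a)
    _ ≤ ∑ k ∈ range (A + 1), ∑ _a : ZMod (m k),
          c k * c A * c j * (lam * (M m A : ℝ≥0∞)⁻¹ * J) := by
        gcongr with k _ a _
        exact lintegral_shiftInt_le hm hl h k A a (measurable_of_dependsOn hg')
    _ ≤ ∑ k ∈ range (A + 1), lam * (c k * c A * c j * (lam * (M m A : ℝ≥0∞)⁻¹ * J)) := by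
        gcongr with k _
        rw [sum_const, card_univ, ZMod.card, nsmul_eq_mul]
        have := hl k
        gcongr
    _ = (∑ k ∈ range (A + 1), c k) * (lam * (c A * c j * (lam * (M m A : ℝ≥0∞)⁻¹ * J))) := by
        rw [sum_mul]
        exact sum_congr rfl fun k _ => by ring
    _ ≤ (4 * c A) * (lam * (c A * c j * (lam * (M m A : ℝ≥0∞)⁻¹ * J))) := by
        gcongr
        exact sum_M_rpow_half_le hm A
    _ = 4 * lam ^ 2 * c j * J * ((c A * c A) * (M m A : ℝ≥0∞)⁻¹) := by ring
    _ = _ := by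
        rw [hc, ENNReal.mul_inv_cancel (M_ne_zero hm A) (ENNReal.natCast_ne_top _), mul_one]

lemma lintegral_fejerMaj_rpow_half_le (hm : ∀ k, 2 ≤ m k) {lam : ℕ} (hl : ∀ k, m k ≤ lam)
    (h : IsHaar m μ) {j : ℕ} {g : Gm m → ℝ≥0∞} (hg : DependsOn g (Set.Iio j)) :
    ∫⁻ x, fejerMaj μ j g x ^ (1 / 2 : ℝ) ∂μ ≤
      (j + 1) * (4 * lam ^ 2 * (M m j : ℝ≥0∞) ^ (1 / 2 : ℝ) * ∫⁻ x, g x ^ (1 / 2 : ℝ) ∂μ) := by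
  have hmeas (A : ℕ) : Measurable fun x => layer μ A g x ^ (1 / 2 : ℝ) := by
    refine Measurable.pow_const ?_ _
    unfold layer
    exact Finset.measurable_fun_sum _ fun k _ => Finset.measurable_fun_sum _ fun a _ =>
      (measurable_of_dependsOn (dependsOn_shiftInt k A a g)).const_mul _
  calc _ ≤ ∫⁻ x, ∑ A ∈ range (j + 1), layer μ A g x ^ (1 / 2 : ℝ) ∂μ :=
        lintegral_mono fun x => sum_rpow_half_le _ _
    _ = ∑ A ∈ range (j + 1), ∫⁻ x, layer μ A g x ^ (1 / 2 : ℝ) ∂μ :=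
        lintegral_finsetSum _ fun A _ => hmeas A
    _ ≤ ∑ _A ∈ range (j + 1),
          4 * lam ^ 2 * (M m j : ℝ≥0∞) ^ (1 / 2 : ℝ) * ∫⁻ x, g x ^ (1 / 2 : ℝ) ∂μ :=
        sum_le_sum fun A hA =>
          lintegral_layer_rpow_half_le hm hl h (Nat.lt_succ_iff.mp (mem_range.mp hA)) hg
    _ = _ := by simp

lemma enorm_fejerSum_le (hm : ∀ k, 2 ≤ m k) {lam : ℕ} (hl : ∀ k, m k ≤ lam) {N n : ℕ}
    (hn : n < M m N) (x t : Gm m) :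
    ‖fejerSum m n (x - t)‖ₑ ≤ 3 * lam ^ 3 * ∑ A ∈ range (N + 1), ∑ k ∈ range (A + 1),
      ∑ a : ZMod (m k), (M m k : ℝ≥0∞) * M m A *
        (cylAt m A (Function.update x k a)).indicator 1 t := by
  rw [← ofReal_norm]
  refine (ENNReal.ofReal_le_ofReal (norm_fejerSum_le hm hl hn _)).trans ?_
  rw [ENNReal.ofReal_mul (by positivity), ENNReal.ofReal_mul (by norm_num),
    ENNReal.ofReal_pow (by positivity), ENNReal.ofReal_natCast, ENNReal.ofReal_ofNat,
    ENNReal.ofReal_sum_of_nonneg fun A _ => axisSum_nonneg A _]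
  gcongr 3 * (lam : ℝ≥0∞) ^ 3 * ?_
  refine (sum_le_sum_of_subset (range_mono N.le_succ)).trans (sum_le_sum fun A _ => ?_)
  have hi (k : ℕ) : 0 ≤ (axis m k A).indicator (1 : Gm m → ℝ) (x - t) :=
    Set.indicator_nonneg (by simp) _
  rw [axisSum, ENNReal.ofReal_sum_of_nonneg fun k _ => mul_nonneg (by positivity) (hi k)]
  refine sum_le_sum fun k _ => ?_
  rw [← mul_sum, ENNReal.ofReal_mul (by positivity), ENNReal.ofReal_mul (by positivity),
    ENNReal.ofReal_natCast, ENNReal.ofReal_natCast]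
  gcongr
  by_cases hx : x - t ∈ axis m k A
  · have ht : t ∈ cylAt m A (Function.update x k (t k)) := by
      intro i hi
      by_cases hik : i = k
      · subst hik
        simp
      · rw [Function.update_of_ne hik]
        exact (sub_eq_zero.mp (hx i hi hik)).symm
    calc _ = (cylAt m A (Function.update x k (t k))).indicator (1 : Gm m → ℝ≥0∞) t := by
          simp [hx, ht]
      _ ≤ _ := single_le_sum
          (f := fun a => (cylAt m A (Function.update x k a)).indicator (1 : Gm m → ℝ≥0∞) t)
          (fun _ _ => zero_le) (mem_univ (t k))
  · simp [hx]

lemma IsMartingale.mul_enorm_sigma_le (hm : ∀ k, 2 ≤ m k) {lam : ℕ} (hl : ∀ k, m k ≤ lam)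
    (h : IsHaar m μ) {f : ℕ → Gm m → ℂ} (hf : IsMartingale m μ f) {n N : ℕ} (hn : n < M m N)
    (x : Gm m) :
    n * ‖sigma m μ f n x‖ₑ ≤ 3 * lam ^ 3 * fejerMaj μ N (fun t => ‖f N t‖ₑ) x := by
  have hfm : Measurable fun t => ‖f N t‖ₑ := (measurable_of_dependsOn (hf.dependsOn N)).enorm
  have hind (k A : ℕ) (a : ZMod (m k)) : Measurable fun t => ‖f N t‖ₑ *
      ((M m k : ℝ≥0∞) * M m A * (cylAt m A (Function.update x k a)).indicator 1 t) :=
    hfm.mul ((measurable_one.indicator (measurableSet_cylAt _ _)).const_mul _)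
  have h0 : (n : ℝ≥0∞) * ‖sigma m μ f n x‖ₑ ≤ ‖∫ t, f N t * fejerSum m n (x - t) ∂μ‖ₑ := by
    rcases eq_or_ne n 0 with rfl | hn0
    · simp
    · have : (n : ℂ) ≠ 0 := by exact_mod_cast hn0
      have hne : (n : ℝ≥0∞) = ‖(n : ℂ)‖ₑ := by simp [enorm_eq_nnnorm]
      rw [hf.sigma_eq hm h hn, hne, ← enorm_mul, ← mul_assoc, mul_inv_cancel₀ this, one_mul]
  refine h0.trans ((enorm_integral_le_lintegral_enorm _).trans ?_)
  calc ∫⁻ t, ‖f N t * fejerSum m n (x - t)‖ₑ ∂μ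
      ≤ ∫⁻ t, 3 * lam ^ 3 * ∑ A ∈ range (N + 1), ∑ k ∈ range (A + 1), ∑ a : ZMod (m k),
          ‖f N t‖ₑ * ((M m k : ℝ≥0∞) * M m A *
            (cylAt m A (Function.update x k a)).indicator 1 t) ∂μ := by
        refine lintegral_mono fun t => ?_
        simp only [← mul_sum]
        rw [enorm_mul, mul_left_comm]
        gcongr
        simpa only [← mul_sum] using enorm_fejerSum_le hm hl hn x t
    _ = 3 * lam ^ 3 * ∑ A ∈ range (N + 1), ∑ k ∈ range (A + 1), ∑ a : ZMod (m k),
          ∫⁻ t, ‖f N t‖ₑ * ((M m k : ℝ≥0∞) * M m A *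
            (cylAt m A (Function.update x k a)).indicator 1 t) ∂μ := by
        rw [lintegral_const_mul _ (Finset.measurable_fun_sum _ fun A _ =>
          Finset.measurable_fun_sum _ fun k _ => Finset.measurable_fun_sum _ fun a _ => hind k A a),
          lintegral_finsetSum _ fun A _ => Finset.measurable_fun_sum _ fun k _ =>
            Finset.measurable_fun_sum _ fun a _ => hind k A a]
        congr 1
        refine sum_congr rfl fun A _ => ?_
        rw [lintegral_finsetSum _ fun k _ => Finset.measurable_fun_sum _ fun a _ => hind k A a]
        exact sum_congr rfl fun k _ => lintegral_finsetSum _ fun a _ => hind k A a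
    _ = _ := by
        simp only [fejerMaj, layer]
        congr 1
        refine sum_congr rfl fun A _ => sum_congr rfl fun k _ => sum_congr rfl fun a _ => ?_
        rw [shiftInt, ← lintegral_const_mul _ hfm, ← lintegral_indicator (measurableSet_cylAt _ _)]
        refine lintegral_congr fun t => ?_
        by_cases ht : t ∈ cylAt m A (Function.update x k a) <;> simp [ht, mul_comm]

end Majorant

section WeightedMaximal

variable {m : ℕ → ℕ} {μ : Measure (Gm m)}

lemma exists_lt_M_le (hm : ∀ k, 2 ≤ m k) {lam : ℕ} (hl : ∀ k, m k ≤ lam) {n : ℕ} (hn : 1 ≤ n) :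
    ∃ N, n < M m N ∧ M m N ≤ lam * n ∧ (N + 1 : ℝ) ≤ 8 * Real.log (n + 1) := by
  classical
  have hex : ∃ N, n < M m N := ⟨n, lt_M_self hm n⟩
  obtain ⟨k, hk⟩ : ∃ k, Nat.find hex = k + 1 := Nat.exists_eq_succ_of_ne_zero fun h0 => by
    have := Nat.find_spec hex
    rw [h0, M] at this
    omega
  have hMk : M m k ≤ n := not_lt.mp (Nat.find_min hex (by omega))
  refine ⟨k + 1, hk ▸ Nat.find_spec hex, Nat.mul_le_mul (hl k) hMk, ?_⟩
  have h2 : (2 : ℝ) ^ k ≤ n := by exact_mod_cast (two_pow_le_M hm k).trans hMk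
  have hn' : (1 : ℝ) ≤ n := by exact_mod_cast hn
  have h3 : Real.log 2 ≤ Real.log (n + 1) := Real.log_le_log (by norm_num) (by linarith)
  have h4 : k * Real.log 2 ≤ Real.log (n + 1) := by
    rw [← Real.log_pow]
    exact Real.log_le_log (by positivity) (by linarith)
  have h5 : (k : ℝ) * (1 / 2) ≤ k * Real.log 2 := by
    gcongr
    linarith [Real.log_two_gt_d9]
  push_cast
  linarith [Real.log_two_gt_d9]

/-- The part of the majorant of the weighted maximal operator which comes from the jump at
time `j`, whose size is `g`. -/
def jumpMaj [∀ k, NeZero (m k)] (μ : Measure (Gm m)) (lam j : ℕ) (g : Gm m → ℝ≥0∞)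
    (x : Gm m) : ℝ≥0∞ :=
  ((j + 1 : ℝ≥0∞) ^ 2)⁻¹ * ((M m j : ℝ≥0∞)⁻¹ * fejerMaj μ j g x + 4 * lam * g x)

lemma lintegral_jumpMaj_rpow_half_le [∀ k, NeZero (m k)] (hm : ∀ k, 2 ≤ m k) {lam : ℕ}
    (hl : ∀ k, m k ≤ lam) (h : IsHaar m μ) {j : ℕ} {g : Gm m → ℝ≥0∞}
    (hg : DependsOn g (Set.Iio j)) :
    ∫⁻ x, jumpMaj μ lam j g x ^ (1 / 2 : ℝ) ∂μ ≤
      8 * lam ^ 2 * ∫⁻ x, g x ^ (1 / 2 : ℝ) ∂μ := by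
  have hlam : (1 : ℝ≥0∞) ≤ lam := by exact_mod_cast (hm 0).trans (hl 0) |>.trans' one_le_two
  have hj0 : (j + 1 : ℝ≥0∞) ≠ 0 := by simp
  have hjt : (j + 1 : ℝ≥0∞) ≠ ⊤ := by exact_mod_cast ENNReal.natCast_ne_top (j + 1)
  have hM0 : (M m j : ℝ≥0∞) ^ (1 / 2 : ℝ) ≠ 0 := by simp [M_ne_zero hm j]
  have hMt : (M m j : ℝ≥0∞) ^ (1 / 2 : ℝ) ≠ ⊤ := by simp
  have hgm := measurable_of_dependsOn hg
  have hpt (x : Gm m) : jumpMaj μ lam j g x ^ (1 / 2 : ℝ) ≤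
      (j + 1 : ℝ≥0∞)⁻¹ * ((M m j : ℝ≥0∞) ^ (1 / 2 : ℝ))⁻¹ * fejerMaj μ j g x ^ (1 / 2 : ℝ) +
        4 * lam * g x ^ (1 / 2 : ℝ) := by
    refine rpow_half_le_of_le_mul_self ?_
    have h1 : fejerMaj μ j g x = fejerMaj μ j g x ^ (1 / 2 : ℝ) * fejerMaj μ j g x ^ (1 / 2 : ℝ) :=
      (rpow_half_mul_self _).symm
    have h2 : g x = g x ^ (1 / 2 : ℝ) * g x ^ (1 / 2 : ℝ) := (rpow_half_mul_self _).symm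
    have h3 : (M m j : ℝ≥0∞)⁻¹ =
        ((M m j : ℝ≥0∞) ^ (1 / 2 : ℝ))⁻¹ * ((M m j : ℝ≥0∞) ^ (1 / 2 : ℝ))⁻¹ := by
      rw [← ENNReal.mul_inv (Or.inl hM0) (Or.inl hMt), rpow_half_mul_self]
    have h4 : ((j + 1 : ℝ≥0∞) ^ 2)⁻¹ = (j + 1 : ℝ≥0∞)⁻¹ * (j + 1 : ℝ≥0∞)⁻¹ := by
      rw [sq, ENNReal.mul_inv (Or.inl hj0) (Or.inl hjt)]
    have h5 : ((j + 1 : ℝ≥0∞) ^ 2)⁻¹ ≤ 1 := by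
      rw [ENNReal.inv_le_one]
      exact one_le_pow₀ le_add_self
    rw [jumpMaj, mul_add]
    set a := fejerMaj μ j g x ^ (1 / 2 : ℝ)
    set b := g x ^ (1 / 2 : ℝ)
    set u := ((M m j : ℝ≥0∞) ^ (1 / 2 : ℝ))⁻¹
    calc _ ≤ ((j + 1 : ℝ≥0∞)⁻¹ * (j + 1 : ℝ≥0∞)⁻¹) * (u * u * (a * a)) +
          1 * (4 * lam * (b * b)) := by
          rw [← h1, ← h2, ← h3, ← h4]
          gcongr
      _ ≤ ((j + 1 : ℝ≥0∞)⁻¹ * u * a) * ((j + 1 : ℝ≥0∞)⁻¹ * u * a) +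
          (4 * lam * b) * (4 * lam * b) := by
          refine add_le_add (le_of_eq (by ring)) ?_
          calc 1 * (4 * lam * (b * b)) ≤ (4 * lam) * (4 * lam * (b * b)) := by
                gcongr
                exact one_le_mul (by norm_num) hlam
            _ = _ := by ring
      _ ≤ _ := by
          rw [add_mul, mul_add, mul_add]
          exact add_le_add le_self_add le_add_self
  calc _ ≤ ∫⁻ x, ((j + 1 : ℝ≥0∞)⁻¹ * ((M m j : ℝ≥0∞) ^ (1 / 2 : ℝ))⁻¹ *
        fejerMaj μ j g x ^ (1 / 2 : ℝ) + 4 * lam * g x ^ (1 / 2 : ℝ)) ∂μ := lintegral_mono hpt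
    _ = (j + 1 : ℝ≥0∞)⁻¹ * ((M m j : ℝ≥0∞) ^ (1 / 2 : ℝ))⁻¹ *
        ∫⁻ x, fejerMaj μ j g x ^ (1 / 2 : ℝ) ∂μ + 4 * lam * ∫⁻ x, g x ^ (1 / 2 : ℝ) ∂μ := by
        rw [lintegral_add_right _ ((hgm.pow_const _).const_mul _),
          lintegral_const_mul _ ((measurable_fejerMaj j g).pow_const _),
          lintegral_const_mul _ (hgm.pow_const _)]
    _ ≤ (j + 1 : ℝ≥0∞)⁻¹ * ((M m j : ℝ≥0∞) ^ (1 / 2 : ℝ))⁻¹ * ((j + 1) *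
          (4 * lam ^ 2 * (M m j : ℝ≥0∞) ^ (1 / 2 : ℝ) * ∫⁻ x, g x ^ (1 / 2 : ℝ) ∂μ)) +
        4 * lam ^ 2 * ∫⁻ x, g x ^ (1 / 2 : ℝ) ∂μ := by
        gcongr
        · exact lintegral_fejerMaj_rpow_half_le hm hl h hg
        · exact le_self_pow₀ hlam two_ne_zero
    _ = ((j + 1 : ℝ≥0∞)⁻¹ * (j + 1)) *
          (((M m j : ℝ≥0∞) ^ (1 / 2 : ℝ))⁻¹ * (M m j : ℝ≥0∞) ^ (1 / 2 : ℝ)) *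
          (4 * lam ^ 2 * ∫⁻ x, g x ^ (1 / 2 : ℝ) ∂μ) +
        4 * lam ^ 2 * ∫⁻ x, g x ^ (1 / 2 : ℝ) ∂μ := by ring
    _ = _ := by
        rw [ENNReal.inv_mul_cancel hj0 hjt, ENNReal.inv_mul_cancel hM0 hMt]
        ring

lemma IsMartingale.enorm_sigma_div_le [∀ k, NeZero (m k)] (hm : ∀ k, 2 ≤ m k) {lam : ℕ}
    (hl : ∀ k, m k ≤ lam) (h : IsHaar m μ) {f : ℕ → Gm m → ℂ} (hf : IsMartingale m μ f)
    {G : ℕ → Gm m → ℝ≥0∞} (hG : ∀ j, DependsOn (G j) (Set.Iio j))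
    (hfG : ∀ N t, ‖f N t‖ₑ ≤ 2 * ∑ j ∈ range (N + 1), G j t) {n : ℕ} (hn : 1 ≤ n) (x : Gm m) :
    ‖sigma m μ f n x‖ₑ / ENNReal.ofReal (Real.log (n + 1) ^ 2) ≤
      384 * lam ^ 4 * ∑' j, jumpMaj μ lam j (G j) x := by
  obtain ⟨N, hnN, hNn, hN⟩ := exists_lt_M_le hm hl hn
  set L := ENNReal.ofReal (Real.log (n + 1) ^ 2)
  have hNL : (N + 1 : ℝ≥0∞) ^ 2 ≤ 64 * L := by
    have h1 : ((N : ℝ) + 1) ^ 2 ≤ 64 * Real.log (n + 1) ^ 2 := by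
      calc ((N : ℝ) + 1) ^ 2 ≤ (8 * Real.log (n + 1)) ^ 2 := by gcongr
        _ = _ := by ring
    have h2 := ENNReal.ofReal_le_ofReal h1
    rw [ENNReal.ofReal_mul (by norm_num), ENNReal.ofReal_pow (by positivity),
      ENNReal.ofReal_add (by positivity) (by norm_num), ENNReal.ofReal_natCast,
      ENNReal.ofReal_one, ENNReal.ofReal_ofNat] at h2
    exact h2
  have hn0 : (n : ℝ≥0∞) ≠ 0 := by exact_mod_cast (by omega : n ≠ 0)
  have hterm : ∀ j ∈ range (N + 1), fejerMaj μ N (G j) x ≤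
      n * (64 * lam * L * jumpMaj μ lam j (G j) x) := fun j hj => by
    have hjN : j ≤ N := Nat.lt_succ_iff.mp (mem_range.mp hj)
    set V := (M m j : ℝ≥0∞)⁻¹ * fejerMaj μ j (G j) x + 4 * lam * G j x with hV
    have h1 : V = (j + 1 : ℝ≥0∞) ^ 2 * jumpMaj μ lam j (G j) x := by
      rw [jumpMaj, ← mul_assoc, ENNReal.mul_inv_cancel (by simp)
        (ENNReal.pow_ne_top (by exact_mod_cast ENNReal.natCast_ne_top (j + 1))), one_mul]
    calc fejerMaj μ N (G j) x ≤ M m N * V := fejerMaj_le hm hl h hjN (hG j) x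
      _ ≤ (lam * n : ℕ) * ((N + 1 : ℝ≥0∞) ^ 2 * jumpMaj μ lam j (G j) x) := by
          rw [h1]
          gcongr
      _ ≤ (lam * n : ℕ) * (64 * L * jumpMaj μ lam j (G j) x) := by gcongr
      _ = _ := by
          push_cast
          ring
  refine ENNReal.div_le_of_le_mul ?_
  rw [← ENNReal.mul_le_mul_iff_right hn0 (ENNReal.natCast_ne_top n)]
  calc _ ≤ 3 * lam ^ 3 * fejerMaj μ N (fun t => ‖f N t‖ₑ) x := hf.mul_enorm_sigma_le hm hl h hnN x
    _ ≤ 3 * lam ^ 3 * (2 * ∑ j ∈ range (N + 1), fejerMaj μ N (G j) x) := by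
        gcongr
        exact fejerMaj_le_two_mul_sum (fun j _ => measurable_of_dependsOn (hG j)) (hfG N) x
    _ ≤ 3 * lam ^ 3 * (2 * ∑ j ∈ range (N + 1), n * (64 * lam * L * jumpMaj μ lam j (G j) x)) := by
        gcongr with j hj
        exact hterm j hj
    _ = n * (384 * lam ^ 4 * (∑ j ∈ range (N + 1), jumpMaj μ lam j (G j) x) * L) := by
        rw [← mul_sum, ← mul_sum]
        ring
    _ ≤ _ := by
        gcongr
        exact ENNReal.sum_le_tsum _

lemma IsMartingale.lintegral_weighted_maximal_le (hm : ∀ k, 2 ≤ m k) {lam : ℕ}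
    (hl : ∀ k, m k ≤ lam) (h : IsHaar m μ) {f : ℕ → Gm m → ℂ} (hf : IsMartingale m μ f) :
    ∫⁻ x, (⨆ n : ℕ, (‖sigma m μ f (n + 1) x‖₊ : ℝ≥0∞) /
        ENNReal.ofReal (Real.log ((n : ℝ) + 2) ^ 2)) ^ (1 / 2 : ℝ) ∂μ ≤
      12288 * lam ^ 6 * ∫⁻ x, mstar m f x ^ (1 / 2 : ℝ) ∂μ := by
  have := neZero_of_two_le hm
  have hlam : (1 : ℝ≥0∞) ≤ lam := by exact_mod_cast (hm 0).trans (hl 0) |>.trans' one_le_two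
  set G : ℕ → Gm m → ℝ≥0∞ := fun j x => jump (fun n => ‖f n x‖ₑ) j
  have hG (j : ℕ) : DependsOn (G j) (Set.Iio j) := fun x y hxy =>
    jump_congr fun i hi => by
      rw [hf.dependsOn i fun k hk => hxy k (lt_of_lt_of_le hk hi)]
  have hGm (j : ℕ) : Measurable (G j) := measurable_of_dependsOn (hG j)
  have hWm (j : ℕ) : Measurable (jumpMaj μ lam j (G j)) :=
    (((measurable_fejerMaj j (G j)).const_mul _).add ((hGm j).const_mul _)).const_mul _
  have hpt (x : Gm m) : (⨆ n : ℕ, (‖sigma m μ f (n + 1) x‖₊ : ℝ≥0∞) /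
        ENNReal.ofReal (Real.log ((n : ℝ) + 2) ^ 2)) ^ (1 / 2 : ℝ) ≤
      384 * lam ^ 4 * ∑' j, jumpMaj μ lam j (G j) x ^ (1 / 2 : ℝ) := by
    refine rpow_half_le_of_le_mul_self (iSup_le fun n => ?_)
    have h1 := hf.enorm_sigma_div_le hm hl h hG
      (fun N t => le_two_mul_sum_jump (fun n => ‖f n t‖ₑ) N) n.succ_pos x
    rw [show ((n.succ : ℕ) : ℝ) + 1 = n + 2 by push_cast; ring] at h1
    refine h1.trans ?_
    set W := fun j => jumpMaj μ lam j (G j) x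
    have h2 : ∑' j, W j ≤ (∑' j, W j ^ (1 / 2 : ℝ)) * ∑' j, W j ^ (1 / 2 : ℝ) := by
      rw [← ENNReal.tsum_mul_right]
      refine ENNReal.tsum_le_tsum fun j => ?_
      calc W j = W j ^ (1 / 2 : ℝ) * W j ^ (1 / 2 : ℝ) := (rpow_half_mul_self _).symm
        _ ≤ _ := by
          gcongr
          exact ENNReal.le_tsum j
    have h3 : (1 : ℝ≥0∞) ≤ 384 * lam ^ 4 := one_le_mul (by norm_num) (one_le_pow₀ hlam)
    calc _ ≤ 384 * lam ^ 4 * ((∑' j, W j ^ (1 / 2 : ℝ)) * ∑' j, W j ^ (1 / 2 : ℝ)) := by gcongr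
      _ = 384 * lam ^ 4 * (∑' j, W j ^ (1 / 2 : ℝ)) * (1 * ∑' j, W j ^ (1 / 2 : ℝ)) := by ring
      _ ≤ _ := by gcongr
  calc _ ≤ ∫⁻ x, 384 * lam ^ 4 * ∑' j, jumpMaj μ lam j (G j) x ^ (1 / 2 : ℝ) ∂μ :=
        lintegral_mono hpt
    _ = 384 * lam ^ 4 * ∑' j, ∫⁻ x, jumpMaj μ lam j (G j) x ^ (1 / 2 : ℝ) ∂μ := by
        rw [lintegral_const_mul _ (Measurable.tsum fun j => (hWm j).pow_const _),
          lintegral_tsum fun j => ((hWm j).pow_const _).aemeasurable]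
    _ ≤ 384 * lam ^ 4 * ∑' j, 8 * lam ^ 2 * ∫⁻ x, G j x ^ (1 / 2 : ℝ) ∂μ := by
        gcongr with j
        exact lintegral_jumpMaj_rpow_half_le hm hl h (hG j)
    _ = 3072 * lam ^ 6 * ∫⁻ x, ∑' j, G j x ^ (1 / 2 : ℝ) ∂μ := by
        rw [ENNReal.tsum_mul_left, lintegral_tsum fun j => ((hGm j).pow_const _).aemeasurable]
        ring
    _ ≤ 3072 * lam ^ 6 * ∫⁻ x, 4 * mstar m f x ^ (1 / 2 : ℝ) ∂μ := by
        gcongr with x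
        exact tsum_jump_rpow_half_le _
    _ = _ := by
        rw [lintegral_const_mul' _ _ (by norm_num)]
        ring

end WeightedMaximal

end Vilenkin

/-- there is `c > 0` (depending only on `λ = sup m_k`) with
`‖ sup_{n ≥ 1} |σ_n f| / log²(n+1) ‖_{L_{1/2}} ≤ c ‖f‖_{H_{1/2}}` for every
martingale `f ∈ H_{1/2}`. -/
theorem statement15 (lam : ℕ) :
    ∃ c : ℝ, 0 < c ∧
      ∀ (m : ℕ → ℕ), (∀ k, 2 ≤ m k) → (∀ k, m k ≤ lam) →
      ∀ (μ : Measure (Gm m)), Vilenkin.IsHaar m μ →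
      ∀ (f : ℕ → Gm m → ℂ), Vilenkin.IsMartingale m μ f →
        Vilenkin.MemHp m μ (1 / 2) f →
        Vilenkin.eLp m μ (1 / 2) (fun x => ⨆ n : ℕ,
            (‖Vilenkin.sigma m μ f (n + 1) x‖₊ : ℝ≥0∞) /
              ENNReal.ofReal (Real.log ((n : ℝ) + 2) ^ 2)) ≤
          ENNReal.ofReal c * Vilenkin.eLp m μ (1 / 2) (Vilenkin.mstar m f) := by
  refine ⟨(12288 * lam ^ 6) ^ 2 + 1, by positivity, fun m hm hl μ h f hf _ => ?_⟩
  have h1 := hf.lintegral_weighted_maximal_le hm hl h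
  have h2 : (1 : ℝ) / (1 / 2) = (2 : ℕ) := by norm_num
  rw [Vilenkin.eLp, Vilenkin.eLp, h2, ENNReal.rpow_natCast, ENNReal.rpow_natCast]
  calc _ ≤ (12288 * (lam : ℝ≥0∞) ^ 6 * ∫⁻ x, Vilenkin.mstar m f x ^ (1 / 2 : ℝ) ∂μ) ^ 2 := by
        gcongr
    _ = ENNReal.ofReal ((12288 * lam ^ 6) ^ 2) *
        (∫⁻ x, Vilenkin.mstar m f x ^ (1 / 2 : ℝ) ∂μ) ^ 2 := by
        rw [mul_pow, ENNReal.ofReal_pow (by positivity), ENNReal.ofReal_mul (by norm_num),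
          ENNReal.ofReal_pow (by positivity), ENNReal.ofReal_natCast, ENNReal.ofReal_ofNat]
    _ ≤ _ := by
        gcongr
        linarith
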